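/- Let k ≥ 1 and let G and H be finite connected graphs of orders m and n with 2 ≤ m ≤ n. Then d_k(G □ H) ≥ min{n + δ(G) − 1, m + δ(H) − 1}. -/

import Mathlib

namespace Deduction

variable {V : Type*}

/-- The number of times searcher `i` has moved before stage `s`. -/
noncomputable def movesBefore {d : ℕ} (t : ℕ → Fin d → V) (i : Fin d) (s : ℕ) : ℕ :=
  Set.ncard {s' : ℕ | s' < s ∧ t (s' + 1) i ≠ t s' i}

/-- The set of vertices protected by stage `s`: those occupied by some searcher
at some stage `s' ≤ s`. -/
def protectedSet {d : ℕ} (t : ℕ → Fin d → V) (s : ℕ) : Set V :=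
  {v | ∃ i : Fin d, ∃ s' ≤ s, t s' i = v}

/-- The unprotected neighbours of `v` at stage `s`. -/
def unprotNbrs (G : SimpleGraph V) {d : ℕ} (t : ℕ → Fin d → V) (s : ℕ) (v : V) : Set V :=
  {u | G.Adj v u ∧ u ∉ protectedSet t s}

/-- The mobile searchers located on `v` at stage `s` (those having moved fewer
than `k` times). -/
def mobileOn (k : ℕ) {d : ℕ} (t : ℕ → Fin d → V) (s : ℕ) (v : V) : Set (Fin d) :=
  {i | t s i = v ∧ movesBefore t i s < k}

/-- A valid play of the `k`-move deduction game with `d` searchers: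
searchers move along edges (or stay); each searcher moves at most `k` times;
the mobile searchers on a vertex `v` move, covering all unprotected neighbours
of `v`, exactly when there is at least one unprotected neighbour and the number
of mobile searchers on `v` is at least the number of unprotected neighbours of
`v`; otherwise the searchers on `v` stay put. -/
def ValidPlay (G : SimpleGraph V) (k : ℕ) {d : ℕ} (t : ℕ → Fin d → V) : Prop :=
  (∀ i s, t (s + 1) i = t s i ∨ G.Adj (t s i) (t (s + 1) i)) ∧
  (∀ i s, movesBefore t i s ≤ k) ∧
  (∀ s v,
    (((unprotNbrs G t s v).Nonempty ∧
        (unprotNbrs G t s v).ncard ≤ (mobileOn k t s v).ncard) →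
      (∀ i ∈ mobileOn k t s v, t (s + 1) i ∈ unprotNbrs G t s v) ∧
      (∀ u ∈ unprotNbrs G t s v, ∃ i ∈ mobileOn k t s v, t (s + 1) i = u)) ∧
    ((¬ ((unprotNbrs G t s v).Nonempty ∧
        (unprotNbrs G t s v).ncard ≤ (mobileOn k t s v).ncard)) →
      ∀ i, t s i = v → t (s + 1) i = t s i))

/-- A successful play: a valid play in which every vertex is eventually
protected (occupied by some searcher at some stage). -/
def Successful (G : SimpleGraph V) (k : ℕ) {d : ℕ} (t : ℕ → Fin d → V) : Prop :=
  ValidPlay G k t ∧ ∀ v : V, ∃ (i : Fin d) (s : ℕ), t s i = v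

/-- The `k`-move deduction number: the least number of searchers admitting a
successful layout (play) of the `k`-move deduction game on `G`. -/
noncomputable def deductionNumber (G : SimpleGraph V) (k : ℕ) : ℕ :=
  sInf {d : ℕ | ∃ t : ℕ → Fin d → V, Successful G k t}

end Deduction

namespace Deduction

/-- The vertex `v` fires at stage `s`. -/
def Fires {V : Type*} (K : SimpleGraph V) (k : ℕ) {d : ℕ} (t : ℕ → Fin d → V) (s : ℕ) (v : V) :
    Prop :=
  (unprotNbrs K t s v).Nonempty ∧ (unprotNbrs K t s v).ncard ≤ (mobileOn k t s v).ncard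

theorem protected_mono {V : Type*} {d : ℕ} (t : ℕ → Fin d → V) {s s' : ℕ} (h : s ≤ s') {v : V}
    (hv : v ∈ protectedSet t s) : v ∈ protectedSet t s' := by
  obtain ⟨i, j, hj, rfl⟩ := hv
  exact ⟨i, j, hj.trans h, rfl⟩

theorem stay {V : Type*} {K : SimpleGraph V} {k d : ℕ} {t : ℕ → Fin d → V}
    (ht : ValidPlay K k t) {v : V} {i : Fin d} {s' s : ℕ} (hs : s' ≤ s) (hi : t s' i = v)
    (hf : ∀ j, s' ≤ j → j < s → ¬ Fires K k t j v) : t s i = v := by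
  induction s, hs using Nat.le_induction with
  | base => exact hi
  | succ n hn ih =>
    have h1 := ih (fun j h1 h2 => hf j h1 (by omega))
    have h2 := (ht.2.2 n v).2 (hf n hn (by omega)) i h1
    rw [h2, h1]

theorem occ_of_not_fires {V : Type*} {K : SimpleGraph V} {k d : ℕ} {t : ℕ → Fin d → V}
    (ht : ValidPlay K k t) {v : V} {s : ℕ} (hv : v ∈ protectedSet t s)
    (hf : ∀ j, j < s → ¬ Fires K k t j v) : ∃ i, t s i = v := by
  obtain ⟨i, s', hs, hi⟩ := hv
  exact ⟨i, stay ht hs hi (fun j _ h => hf j h)⟩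

theorem boundary {V : Type*} {K : SimpleGraph V} {k d : ℕ} {t : ℕ → Fin d → V}
    (ht : ValidPlay K k t) {v u : V} {s : ℕ} (hv : v ∈ protectedSet t s) (hu : K.Adj v u)
    (hup : u ∉ protectedSet t s) : ∃ i, t s i = v := by
  refine occ_of_not_fires ht hv (fun j hj hF => hup ?_)
  have hmem : u ∈ unprotNbrs K t j v := ⟨hu, fun h => hup (protected_mono t hj.le h)⟩
  obtain ⟨i, -, hi⟩ := ((ht.2.2 j v).1 hF).2 u hmem
  exact ⟨i, j + 1, hj, hi⟩

theorem occupied_of_fires {V : Type*} {K : SimpleGraph V} {k d : ℕ} {t : ℕ → Fin d → V}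
    [Finite V] {v : V} {s : ℕ} (hF : Fires K k t s v) : ∃ i, t s i = v := by
  obtain ⟨h1, h2⟩ := hF
  by_contra! hne
  have h3 : mobileOn k t s v = ∅ := by
    ext i
    simp [mobileOn, hne i]
  rw [h3, Set.ncard_empty] at h2
  have h4 := (Set.ncard_pos (Set.toFinite _)).2 h1
  omega

theorem count {ι : Type*} [Fintype ι] [DecidableEq ι] {d : ℕ} (f : Fin d → ι) (x : ι) (c : ℕ)
    (hocc : ∀ a, ∃ i, f i = a) (hc : c ≤ (Finset.univ.filter (fun i => f i = x)).card) :
    Fintype.card ι + c - 1 ≤ d := by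
  have h1 : d = ∑ a, (Finset.univ.filter (fun i => f i = a)).card := by
    have := Finset.card_eq_sum_card_fiberwise (f := f) (s := Finset.univ) (t := Finset.univ)
      (by simp)
    simpa using this
  have h2 : ∑ a ∈ Finset.univ.erase x, 1 ≤
      ∑ a ∈ Finset.univ.erase x, (Finset.univ.filter (fun i => f i = a)).card := by
    refine Finset.sum_le_sum (fun a _ => ?_)
    obtain ⟨i, hi⟩ := hocc a
    exact Finset.card_pos.2 ⟨i, by simp [hi]⟩
  have h3 := Finset.add_sum_erase Finset.univ
    (fun a => (Finset.univ.filter (fun i => f i = a)).card) (Finset.mem_univ x)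
  simp only [Finset.sum_const, Finset.card_erase_of_mem (Finset.mem_univ x), Finset.card_univ,
    smul_eq_mul, mul_one] at h2 h3
  omega

/-- If a set is nonempty and not everything in a connected graph, it has a boundary edge. -/
theorem exists_boundary {β : Type*} {H : SimpleGraph β} (hH : H.Connected) (P : β → Prop)
    {a b : β} (ha : P a) (hb : ¬ P b) : ∃ u v, H.Adj u v ∧ P u ∧ ¬ P v := by
  obtain ⟨w⟩ := hH.preconnected a b
  obtain ⟨e, -, h1, h2⟩ := w.exists_boundary_dart {x | P x} ha hb
  exact ⟨e.fst, e.snd, e.adj, h1, h2⟩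

theorem key {α β V : Type*} [Fintype α] [Fintype β] {K : SimpleGraph V} {H : SimpleGraph β}
    [DecidableRel H.Adj] (hH : H.Connected) (e : α × β ≃ V)
    (hK : ∀ a b b', H.Adj b b' → K.Adj (e (a, b)) (e (a, b')))
    {k d : ℕ} {t : ℕ → Fin d → V} (ht : ValidPlay K k t) {s : ℕ}
    (htouch : ∀ a, ∃ b, e (a, b) ∈ protectedSet t s) (x : α) (y : β)
    (hx : ∀ j, j < s → ∀ b, ¬ Fires K k t j (e (x, b)))
    (hy : ∀ j, j < s → ∀ a, ¬ Fires K k t j (e (a, y)))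
    (hfin : (∃ b, Fires K k t s (e (x, b))) ∨ ∀ v, v ∈ protectedSet t s) :
    Fintype.card α + H.minDegree - 1 ≤ d := by
  classical
  haveI : Fintype V := Fintype.ofEquiv _ e
  refine count (fun i => (e.symm (t s i)).1) x H.minDegree ?_ ?_
  · intro a
    have : ∃ b i, t s i = e (a, b) := by
      by_cases hp : e (a, y) ∈ protectedSet t s
      · exact ⟨y, occ_of_not_fires ht hp (fun j hj => hy j hj a)⟩
      · obtain ⟨b, hb⟩ := htouch a
        obtain ⟨u, v, huv, hu, hv⟩ := exists_boundary hH (fun b => e (a, b) ∈ protectedSet t s) hb hp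
        exact ⟨u, boundary ht hu (hK a u v huv) hv⟩
    obtain ⟨b, i, hi⟩ := this
    exact ⟨i, by simp [hi]⟩
  · have hocc : ∀ b, e (x, b) ∈ protectedSet t s → ∃ i, t s i = e (x, b) :=
      fun b hb => occ_of_not_fires ht hb (fun j hj => hx j hj b)
    rcases hfin with ⟨b, hF⟩ | hall
    · refine (H.minDegree_le_degree b).trans ?_
      rw [← SimpleGraph.card_neighborFinset_eq_degree,
        ← Finset.card_filter_add_card_filter_not (fun c => e (x, c) ∈ protectedSet t s)]
      have hA : ((H.neighborFinset b).filter (fun c => e (x, c) ∈ protectedSet t s)).card ≤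
          (Finset.univ.filter (fun i => (e.symm (t s i)).1 = x ∧ t s i ≠ e (x, b))).card := by
        refine (Finset.card_le_card ?_).trans (Finset.card_image_le (f := fun i => (e.symm (t s i)).2))
        intro c hc
        simp only [Finset.mem_filter, SimpleGraph.mem_neighborFinset] at hc
        obtain ⟨i, hi⟩ := hocc c hc.2
        have := hc.1.ne'
        simp only [Finset.mem_image, Finset.mem_filter, Finset.mem_univ, true_and]
        exact ⟨i, by simp [hi, this], by simp [hi]⟩
      have hB : ((H.neighborFinset b).filter (fun c => ¬ e (x, c) ∈ protectedSet t s)).card ≤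
          (Finset.univ.filter (fun i => (e.symm (t s i)).1 = x ∧ ¬ t s i ≠ e (x, b))).card := by
        have h1 : ((H.neighborFinset b).filter (fun c => ¬ e (x, c) ∈ protectedSet t s)).card ≤
            (unprotNbrs K t s (e (x, b))).ncard := by
          rw [← Set.ncard_coe_finset]
          refine Set.ncard_le_ncard_of_injOn (fun c => e (x, c)) ?_ ?_ (Set.toFinite _)
          · intro c hc
            simp only [Finset.coe_filter, SimpleGraph.mem_neighborFinset, Set.mem_setOf_eq] at hc
            exact ⟨hK x b c hc.1, hc.2⟩
          · intro c _ c' _ h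
            simpa using h
        refine (h1.trans hF.2).trans ?_
        rw [← Set.ncard_coe_finset]
        refine Set.ncard_le_ncard ?_ (Set.toFinite _)
        intro i hi
        have := hi.1
        simp [this]
      have hC := Finset.card_filter_add_card_filter_not
        (s := Finset.univ.filter (fun i => (e.symm (t s i)).1 = x)) (fun i => t s i ≠ e (x, b))
      rw [Finset.filter_filter, Finset.filter_filter] at hC
      omega
    · haveI : Nonempty β := ⟨y⟩
      refine (H.minDegree_lt_card).le.trans ?_
      rw [← Finset.card_univ]
      refine (Finset.card_le_card ?_).trans (Finset.card_image_le (f := fun i => (e.symm (t s i)).2))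
      intro c _
      obtain ⟨i, hi⟩ := hocc c (hall _)
      simp only [Finset.mem_image, Finset.mem_filter, Finset.mem_univ, true_and]
      exact ⟨i, by simp [hi], by simp [hi]⟩

/-- There is a column which fires only after all columns are touched. -/
theorem exists_late {α β V : Type*} [Nonempty α] [Finite V] (e : α × β ≃ V) {K : SimpleGraph V}
    {k d : ℕ} {t : ℕ → Fin d → V} (htot : ∃ s, ∀ v, v ∈ protectedSet t s) [Nonempty β] :
    ∃ x : α, ∀ s b, Fires K k t s (e (x, b)) → ∀ a, ∃ b, e (a, b) ∈ protectedSet t s := by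
  classical
  have hex : ∃ s, ∀ a, ∃ b, e (a, b) ∈ protectedSet t s := by
    obtain ⟨s, hs⟩ := htot
    exact ⟨s, fun a => ⟨Classical.arbitrary β, hs _⟩⟩
  by_cases h0 : Nat.find hex = 0
  · refine ⟨Classical.arbitrary α, fun s b _ a => ?_⟩
    obtain ⟨b, hb⟩ := Nat.find_spec hex a
    exact ⟨b, protected_mono t (by omega) hb⟩
  · have hlt := Nat.find_min hex (m := Nat.find hex - 1) (by omega)
    push Not at hlt
    obtain ⟨x, hx⟩ := hlt
    refine ⟨x, fun s b hF a => ?_⟩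
    obtain ⟨c, hc⟩ := Nat.find_spec hex a
    refine ⟨c, protected_mono t ?_ hc⟩
    by_contra hlt
    obtain ⟨i, hi⟩ := occupied_of_fires hF
    exact hx b ⟨i, s, by omega, hi⟩

end Deduction

open SimpleGraph in
/-- Product lower bound: `d_k(G □ H) ≥ min {n + δ(G) - 1, m + δ(H) - 1}`. -/
theorem stmt_15 {α β : Type*} [Fintype α] [Fintype β]
    (G : SimpleGraph α) (H : SimpleGraph β)
    [DecidableRel G.Adj] [DecidableRel H.Adj]
    (k m n : ℕ) (hk : 1 ≤ k) (hG : G.Connected) (hH : H.Connected)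
    (hm : Fintype.card α = m) (hn : Fintype.card β = n)
    (h2 : 2 ≤ m) (hmn : m ≤ n) :
    min (n + G.minDegree - 1) (m + H.minDegree - 1) ≤
      Deduction.deductionNumber (G □ H) k := by
  classical
  subst hm hn
  have hne : {d : ℕ | ∃ t : ℕ → Fin d → α × β, Deduction.Successful (G □ H) k t}.Nonempty := by
    refine ⟨Fintype.card (α × β), fun _ i => (Fintype.equivFin (α × β)).symm i, ⟨?_, ?_, ?_⟩, ?_⟩
    · intro i s
      exact Or.inl rfl
    · intro i s
      simp [Deduction.movesBefore]
    · intro s v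
      refine ⟨fun h => ?_, fun _ i _ => rfl⟩
      obtain ⟨u, hu⟩ := h.1
      exact absurd ⟨Fintype.equivFin (α × β) u, 0, Nat.zero_le _, by simp⟩ hu.2
    · intro v
      exact ⟨Fintype.equivFin (α × β) v, 0, by simp⟩
  obtain ⟨t, ht, hall⟩ := Nat.sInf_mem hne
  change _ ≤ sInf {d : ℕ | ∃ t : ℕ → Fin d → α × β, Deduction.Successful (G □ H) k t}
  generalize sInf {d : ℕ | ∃ t : ℕ → Fin d → α × β, Deduction.Successful (G □ H) k t} = d at t ht hall ⊢
  haveI := hG.nonempty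
  haveI := hH.nonempty
  have htot : ∃ s, ∀ v, v ∈ Deduction.protectedSet t s := by
    choose i s hs using hall
    refine ⟨Finset.univ.sup s, fun v => ⟨i v, s v, Finset.le_sup (Finset.mem_univ v), hs v⟩⟩
  obtain ⟨x, hx⟩ := Deduction.exists_late (K := G □ H) (k := k) (Equiv.refl (α × β)) htot
  obtain ⟨y, hy⟩ := Deduction.exists_late (K := G □ H) (k := k) (Equiv.prodComm β α) htot
  have hK1 : ∀ a b b', H.Adj b b' →
      (G □ H).Adj (Equiv.refl (α × β) (a, b)) (Equiv.refl (α × β) (a, b')) := by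
    intro a b b' h
    simpa [SimpleGraph.boxProd_adj] using h
  have hK2 : ∀ a b b', G.Adj b b' →
      (G □ H).Adj (Equiv.prodComm β α (a, b)) (Equiv.prodComm β α (a, b')) := by
    intro a b b' h
    simpa [SimpleGraph.boxProd_adj] using h
  by_cases hex : ∃ s, (∃ b, Deduction.Fires (G □ H) k t s (x, b)) ∨
      ∃ a, Deduction.Fires (G □ H) k t s (a, y)
  · have hmin : ∀ j, j < Nat.find hex → (∀ b, ¬ Deduction.Fires (G □ H) k t j (x, b)) ∧
        ∀ a, ¬ Deduction.Fires (G □ H) k t j (a, y) := by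
      intro j hj
      have := Nat.find_min hex hj
      push Not at this
      exact this
    rcases Nat.find_spec hex with hF | hF
    · obtain ⟨b, hb⟩ := id hF
      exact (min_le_right _ _).trans (Deduction.key hH (Equiv.refl (α × β)) hK1 ht
        (hx _ b hb) x y (fun j hj => (hmin j hj).1) (fun j hj => (hmin j hj).2) (Or.inl hF))
    · obtain ⟨a, ha⟩ := id hF
      exact (min_le_left _ _).trans (Deduction.key hG (Equiv.prodComm β α) hK2 ht
        (hy _ a ha) y x (fun j hj => (hmin j hj).2) (fun j hj => (hmin j hj).1) (Or.inl hF))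
  · push Not at hex
    obtain ⟨s, hs⟩ := htot
    exact (min_le_right _ _).trans (Deduction.key hH (Equiv.refl (α × β)) hK1 ht
      (fun a => ⟨y, hs _⟩) x y (fun j _ => (hex j).1) (fun j _ => (hex j).2) (Or.inr hs))
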